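/- arXiv:1002.4019 — 2 statements merged into one kernel-verified Lean document; each statement's English description precedes it below -/
import Mathlib

section
/- Let λ > 1 and set α := 1/(1 + log₂ λ). For any full binary group-identification tree T (leaves labeled by disjoint nonempty pure subsets partitioning Θ), the following exact identity holds: Σ_{j ∈ leaves} π_{Θ_j} λ^{d_j} = λ^{H_α(Π_y)} + Σ_{a ∈ I} π_{Θ_a} [ (λ − 1) λ^{d_a} − D_α(Θ_a) + (π_{Θ_{l(a)}}/π_{Θ_a}) D_α(Θ_{l(a)}) + (π_{Θ_{r(a)}}/π_{Θ_a}) D_α(Θ_{r(a)}) ], where D_α is computed from the group masses. Equivalently, the exponential cost L_λ(Π) := log_λ(Σ_{j} π_{Θ_j} λ^{d_j}) equals log_λ of the right-hand side. -/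
/-- A full binary tree with leaves labeled by elements of `σ`. For group
identification, leaves are labeled by subsets of the object set. -/
inductive BTree (σ : Type) : Type where
  | leaf : σ → BTree σ
  | node : BTree σ → BTree σ → BTree σ

namespace BTree

variable {σ : Type}

/-- The list of leaf labels of a tree. -/
def leaves : BTree σ → List σ
  | .leaf a => [a]
  | .node l r => leaves l ++ leaves r

/-- The list of leaf labels together with their depths (root has depth 0). -/
def leavesD : BTree σ → List (σ × ℕ)
  | .leaf a => [(a, 0)]
  | .node l r => (leavesD l ++ leavesD r).map fun p => (p.1, p.2 + 1)

/-- The list of internal nodes (as subtrees) together with their depths. -/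
def internals : BTree σ → List (BTree σ × ℕ)
  | .leaf _ => []
  | .node l r => (.node l r, 0) :: ((internals l ++ internals r).map fun p => (p.1, p.2 + 1))

/-- Left child (identity on leaves). -/
def left : BTree σ → BTree σ
  | .leaf a => .leaf a
  | .node l _ => l

/-- Right child (identity on leaves). -/
def right : BTree σ → BTree σ
  | .leaf a => .leaf a
  | .node _ r => r

variable {ι : Type} [DecidableEq ι]

/-- `objs t` is the set `Θ_a` of objects at the leaves of the subtree `t`. -/
def objs : BTree (Finset ι) → Finset ι
  | .leaf S => S
  | .node l r => objs l ∪ objs r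

end BTree

variable {ι : Type} [DecidableEq ι] {m : ℕ}

/-- `π_{Θ_a}`, the total weight of the objects at the node rooting `t`. -/
noncomputable def gmass (π : ι → ℝ) (t : BTree (Finset ι)) : ℝ := ∑ k ∈ t.objs, π k

/-- `π_{Θ_a^i}`, the total weight of group-`i` objects at the node rooting `t`. -/
noncomputable def gmassGroup (π : ι → ℝ) (y : ι → Fin m) (i : Fin m)
    (t : BTree (Finset ι)) : ℝ :=
  ∑ k ∈ t.objs.filter (fun k => y k = i), π k

/-- `D_α(Θ_a) = (∑_{i=1}^m (π_{Θ_a^i}/π_{Θ_a})^α)^{1/α}` computed from the group masses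
(terms with `π_{Θ_a^i} = 0` contribute `0` since `0^α = 0` for `α > 0`). -/
noncomputable def gD (π : ι → ℝ) (y : ι → Fin m) (α : ℝ) (t : BTree (Finset ι)) : ℝ :=
  (∑ i : Fin m, (gmassGroup π y i t / gmass π t) ^ α) ^ (1 / α)

lemma BTree.disjoint_objs {A : Finset ι} {t : BTree (Finset ι)}
    (h : ∀ S ∈ t.leaves, Disjoint A S) : Disjoint A t.objs := by
  induction t with
  | leaf S => exact h S (by simp [BTree.leaves])
  | node l r ihl ihr =>
    simp only [BTree.leaves, List.mem_append] at h
    simp only [BTree.objs, Finset.disjoint_union_right]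
    exact ⟨ihl fun S hS => h S (Or.inl hS), ihr fun S hS => h S (Or.inr hS)⟩

lemma BTree.disjoint_objs_objs {l r : BTree (Finset ι)}
    (h : ∀ S ∈ l.leaves, ∀ S' ∈ r.leaves, Disjoint S S') : Disjoint l.objs r.objs :=
  BTree.disjoint_objs fun S' hS' => (BTree.disjoint_objs fun S hS => (h S hS S' hS').symm).symm

lemma gmass_node (π : ι → ℝ) {l r : BTree (Finset ι)}
    (h : (BTree.node l r).leaves.Pairwise Disjoint) :
    gmass π (.node l r) = gmass π l + gmass π r := by
  rw [BTree.leaves, List.pairwise_append] at h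
  exact Finset.sum_union (BTree.disjoint_objs_objs h.2.2)

lemma gmass_pos {π : ι → ℝ} (hπ : ∀ k, 0 < π k) {t : BTree (Finset ι)}
    (hne : ∀ S ∈ t.leaves, S.Nonempty) : 0 < gmass π t := by
  refine Finset.sum_pos (fun k _ => hπ k) ?_
  induction t with
  | leaf S => exact hne S (by simp [BTree.leaves])
  | node l r ihl _ =>
    exact (ihl fun S hS => hne S (by simp [BTree.leaves, hS])).mono Finset.subset_union_left

/-- A sum over internal nodes of a tree splits into the root term and the sums over the two
subtrees with all depths shifted by one. -/
lemma sum_internals_node {σ : Type} (f : BTree σ → ℕ → ℝ) (l r : BTree σ) :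
    ((BTree.node l r).internals.map fun p => f p.1 p.2).sum
      = f (.node l r) 0 + ((l.internals.map fun p => f p.1 (p.2 + 1)).sum
        + (r.internals.map fun p => f p.1 (p.2 + 1)).sum) := by
  simp [BTree.internals, Function.comp_def]

/-- The exponential cost is the root mass plus the increments at the internal nodes. -/
lemma exponential_cost_eq (π : ι → ℝ) (lam : ℝ) {t : BTree (Finset ι)}
    (hdisj : t.leaves.Pairwise Disjoint) :
    (t.leavesD.map fun p => (∑ k ∈ p.1, π k) * lam ^ p.2).sum
      = gmass π t + (t.internals.map fun p => gmass π p.1 * ((lam - 1) * lam ^ p.2)).sum := by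
  induction t with
  | leaf S => simp [BTree.leavesD, BTree.internals, gmass, BTree.objs]
  | node l r ihl ihr =>
    have hm := gmass_node π hdisj
    rw [BTree.leaves, List.pairwise_append] at hdisj
    have hl := ihl hdisj.1
    have hr := ihr hdisj.2.1
    have key (u : List (Finset ι × ℕ)) :
        (u.map fun p => (∑ k ∈ p.1, π k) * lam ^ (p.2 + 1)).sum
          = lam * (u.map fun p => (∑ k ∈ p.1, π k) * lam ^ p.2).sum := by
      rw [← List.sum_map_mul_left]
      simp only [pow_succ']
      congr 2
      funext p
      ring
    have key' (u : List (BTree (Finset ι) × ℕ)) :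
        (u.map fun p => gmass π p.1 * ((lam - 1) * lam ^ (p.2 + 1))).sum
          = lam * (u.map fun p => gmass π p.1 * ((lam - 1) * lam ^ p.2)).sum := by
      rw [← List.sum_map_mul_left]
      simp only [pow_succ']
      congr 2
      funext p
      ring
    rw [sum_internals_node fun a d => gmass π a * ((lam - 1) * lam ^ d), key', key']
    simp only [BTree.leavesD, List.map_map, List.map_append, List.sum_append, Function.comp_def]
    rw [key, key, hl, hr, hm]
    ring

lemma gD_leaf {π : ι → ℝ} (y : ι → Fin m) {α : ℝ} (hα : α ≠ 0) {S : Finset ι}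
    (hmass : ∑ k ∈ S, π k ≠ 0) (hpure : ∀ k ∈ S, ∀ k' ∈ S, y k = y k') :
    gD π y α (.leaf S) = 1 := by
  obtain ⟨k, hk, -⟩ := Finset.exists_ne_zero_of_sum_ne_zero hmass
  have h : ∑ i : Fin m, (gmassGroup π y i (.leaf S) / gmass π (.leaf S)) ^ α = 1 := by
    rw [Finset.sum_eq_single (y k)]
    · have : S.filter (fun k' => y k' = y k) = S :=
        Finset.filter_true_of_mem fun k' hk' => hpure k' hk' k hk
      simp [gmassGroup, gmass, BTree.objs, this, div_self hmass]
    · intro i _ hi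
      have : S.filter (fun k' => y k' = i) = ∅ :=
        Finset.filter_false_of_mem fun k' hk' h => hi (h ▸ hpure k' hk' k hk)
      simp [gmassGroup, BTree.objs, this, Real.zero_rpow hα]
    · simp
  rw [gD, h, Real.one_rpow]

/-- The increments of the weighted impurity `π_{Θ_a} D_α(Θ_a)` telescope along the tree. -/
lemma sum_internals_gD {π : ι → ℝ} (hπ : ∀ k, 0 < π k) (y : ι → Fin m) {α : ℝ} (hα : α ≠ 0)
    {t : BTree (Finset ι)} (hne : ∀ S ∈ t.leaves, S.Nonempty)
    (hdisj : t.leaves.Pairwise Disjoint)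
    (hpure : ∀ S ∈ t.leaves, ∀ k ∈ S, ∀ k' ∈ S, y k = y k') :
    (t.internals.map fun p =>
        gmass π p.1 * (- gD π y α p.1
          + (gmass π p.1.left / gmass π p.1) * gD π y α p.1.left
          + (gmass π p.1.right / gmass π p.1) * gD π y α p.1.right)).sum
      = gmass π t - gmass π t * gD π y α t := by
  induction t with
  | leaf S =>
    have hS : ∑ k ∈ S, π k ≠ 0 := (gmass_pos hπ hne).ne'
    rw [gD_leaf y hα hS (hpure S (by simp [BTree.leaves]))]
    simp [BTree.internals]
  | node l r ihl ihr =>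
    have hm := gmass_node π hdisj
    have hpos := gmass_pos hπ hne
    rw [BTree.leaves, List.pairwise_append] at hdisj
    simp only [BTree.leaves, List.mem_append] at hne hpure
    have hl := ihl (fun S hS => hne S (Or.inl hS)) hdisj.1 (fun S hS => hpure S (Or.inl hS))
    have hr := ihr (fun S hS => hne S (Or.inr hS)) hdisj.2.1 (fun S hS => hpure S (Or.inr hS))
    rw [sum_internals_node fun a _ => gmass π a * (- gD π y α a
          + (gmass π a.left / gmass π a) * gD π y α a.left
          + (gmass π a.right / gmass π a) * gD π y α a.right), hl, hr]
    simp only [BTree.left, BTree.right]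
    field_simp
    rw [hm]
    ring

/-- `λ` raised to the Rényi entropy `(1 - α)⁻¹ log₂ x` is `x ^ (1 / α)` when
`α = 1 / (1 + log₂ λ)`. -/
lemma rpow_renyi_eq {lam α x : ℝ} (hlam : 1 < lam) (hα : α = 1 / (1 + Real.logb 2 lam))
    (hx : 0 < x) : lam ^ ((1 / (1 - α)) * Real.logb 2 x) = x ^ (1 / α) := by
  have hlog : 0 < Real.log lam := Real.log_pos hlam
  have h2 : 0 < Real.log 2 := Real.log_pos one_lt_two
  rw [Real.rpow_def_of_pos (by linarith), Real.rpow_def_of_pos hx]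
  have hne : Real.log 2 + Real.log lam ≠ 0 := by positivity
  have h1 : 1 - α = Real.log lam / (Real.log 2 + Real.log lam) := by
    rw [hα, Real.logb]
    field_simp
    ring
  congr 1
  rw [h1, hα]
  simp only [Real.logb]
  field_simp

/-- **Theorem 2 (group identification).** For `λ > 1` and `α = 1/(1 + log₂ λ)`, for any
group-identification tree (leaves labeled by nonempty, pairwise disjoint, pure subsets
partitioning `Θ`), the exponential cost satisfies the exact identity
`∑_{j ∈ leaves} π_{Θ_j} λ^{d_j} = λ^{H_α(Π_y)} + ∑_{a ∈ I} π_{Θ_a} [(λ-1)λ^{d_a} - D_α(Θ_a)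
  + (π_{Θ_{l(a)}}/π_{Θ_a}) D_α(Θ_{l(a)}) + (π_{Θ_{r(a)}}/π_{Θ_a}) D_α(Θ_{r(a)})]`. -/
theorem group_exponential_cost_identity {ι : Type} [Fintype ι] [DecidableEq ι] {m : ℕ}
    (π : ι → ℝ) (hπ : ∀ k, 0 < π k) (hsum : ∑ k, π k = 1) (y : ι → Fin m)
    (lam : ℝ) (hlam : 1 < lam) (α : ℝ) (hα : α = 1 / (1 + Real.logb 2 lam))
    (T : BTree (Finset ι))
    (hne : ∀ S ∈ T.leaves, S.Nonempty)
    (hdisj : T.leaves.Pairwise Disjoint)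
    (hunion : T.objs = Finset.univ)
    (hpure : ∀ S ∈ T.leaves, ∀ k ∈ S, ∀ k' ∈ S, y k = y k') :
    (T.leavesD.map fun p => (∑ k ∈ p.1, π k) * lam ^ p.2).sum
      = lam ^ ((1 / (1 - α)) *
            Real.logb 2 (∑ i : Fin m, (∑ k ∈ Finset.univ.filter (fun k => y k = i), π k) ^ α))
        + (T.internals.map fun p =>
            gmass π p.1 *
              ((lam - 1) * lam ^ p.2 - gD π y α p.1
                + (gmass π p.1.left / gmass π p.1) * gD π y α p.1.left
                + (gmass π p.1.right / gmass π p.1) * gD π y α p.1.right)).sum := by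
  have hlogb : 0 < Real.logb 2 lam := Real.logb_pos one_lt_two hlam
  have hα0 : α ≠ 0 := by rw [hα]; positivity
  have hmass : gmass π T = 1 := by rw [gmass, hunion, hsum]
  have hroot : lam ^ ((1 / (1 - α)) * Real.logb 2
      (∑ i : Fin m, (∑ k ∈ Finset.univ.filter (fun k => y k = i), π k) ^ α)) = gD π y α T := by
    rw [rpow_renyi_eq hlam hα]
    · simp [gD, gmassGroup, hmass, hunion]
    · obtain ⟨k, -, -⟩ := Finset.exists_ne_zero_of_sum_ne_zero (hsum.trans_ne one_ne_zero)
      refine Finset.sum_pos' (fun i _ => Real.rpow_nonneg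
        (Finset.sum_nonneg fun k _ => (hπ k).le) _) ⟨y k, Finset.mem_univ _, ?_⟩
      exact Real.rpow_pos_of_pos (Finset.sum_pos (fun k _ => hπ k) ⟨k, by simp⟩) _
  have htel := sum_internals_gD hπ y hα0 hne hdisj hpure
  rw [exponential_cost_eq π lam hdisj, hroot]
  rw [hmass, one_mul] at htel
  rw [hmass, sub_eq_iff_eq_add'.mp htel.symm, add_assoc, ← List.sum_map_add]
  congr 3
  funext p
  ring
end

section
/- Let α ∈ (0,1). For any full binary group-identification tree T whose leaves are labeled by disjoint nonempty pure subsets of the object set Θ (objects with positive weights π_k and group labels y_k ∈ {1,…,m}), the following telescoping identity holds: ( Σ_{i=1}^m π_{Θ^i}^α )^{1/α} − π_Θ = Σ_{a ∈ I} [ π_{Θ_a} D_α(Θ_a) − π_{Θ_{l(a)}} D_α(Θ_{l(a)}) − π_{Θ_{r(a)}} D_α(Θ_{r(a)}) ], where π_Θ is the total weight of all objects. -/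
variable {ι : Type} [DecidableEq ι] {m : ℕ}

theorem sum_map_internals_sub_children {σ : Type} (F : BTree σ → ℝ) (T : BTree σ) :
    (T.internals.map fun p => F p.1 - F p.1.left - F p.1.right).sum
      = F T - (T.leaves.map fun S => F (.leaf S)).sum := by
  induction T with
  | leaf S => simp [BTree.internals, BTree.leaves]
  | node l r ihl ihr =>
    simp only [BTree.internals, BTree.leaves, List.map_cons, List.map_append, List.map_map,
      List.sum_cons, List.sum_append, Function.comp_def, ihl, ihr]
    simp only [BTree.left, BTree.right]
    ring

theorem BTree.mem_objs {t : BTree (Finset ι)} {k : ι} :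
    k ∈ t.objs ↔ ∃ S ∈ t.leaves, k ∈ S := by
  induction t with
  | leaf S => simp [BTree.objs, BTree.leaves]
  | node l r ihl ihr => simp [BTree.objs, BTree.leaves, ihl, ihr, or_and_right, exists_or]

theorem gmass_eq_sum_leaves (π : ι → ℝ) (t : BTree (Finset ι))
    (hdisj : t.leaves.Pairwise Disjoint) :
    gmass π t = (t.leaves.map fun S => ∑ k ∈ S, π k).sum := by
  unfold gmass
  induction t with
  | leaf S => simp [BTree.objs, BTree.leaves]
  | node l r ihl ihr =>
    obtain ⟨hl, hr, hlr⟩ := List.pairwise_append.mp hdisj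
    have hd : Disjoint l.objs r.objs := by
      rw [Finset.disjoint_left]
      intro k hkl hkr
      obtain ⟨S, hS, hkS⟩ := BTree.mem_objs.mp hkl
      obtain ⟨S', hS', hkS'⟩ := BTree.mem_objs.mp hkr
      exact Finset.disjoint_left.mp (hlr S hS S' hS') hkS hkS'
    simp only [BTree.objs, BTree.leaves, List.map_append, List.sum_append]
    rw [Finset.sum_union hd, ihl hl, ihr hr]

theorem gmass_mul_gD {π : ι → ℝ} (hπ : ∀ k, 0 ≤ π k) (y : ι → Fin m) {α : ℝ} (hα : α ≠ 0)
    {t : BTree (Finset ι)} (ht : 0 < gmass π t) :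
    gmass π t * gD π y α t = (∑ i, gmassGroup π y i t ^ α) ^ (1 / α) := by
  have hg : ∀ i, 0 ≤ gmassGroup π y i t := fun i => Finset.sum_nonneg fun k _ => hπ k
  have hs : 0 ≤ ∑ i, gmassGroup π y i t ^ α :=
    Finset.sum_nonneg fun i _ => Real.rpow_nonneg (hg i) α
  simp only [gD, Real.div_rpow (hg _) ht.le]
  rw [← Finset.sum_div, Real.div_rpow hs (Real.rpow_nonneg ht.le α), one_div,
    Real.rpow_rpow_inv ht.le hα, mul_div_cancel₀ _ ht.ne']

theorem gmass_mul_gD_leaf {π : ι → ℝ} (hπ : ∀ k, 0 < π k) (y : ι → Fin m) {α : ℝ} (hα : α ≠ 0)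
    {S : Finset ι} (hS : S.Nonempty) (hpure : ∀ k ∈ S, ∀ k' ∈ S, y k = y k') :
    gmass π (.leaf S) * gD π y α (.leaf S) = ∑ k ∈ S, π k := by
  have hpos : 0 < ∑ k ∈ S, π k := Finset.sum_pos (fun k _ => hπ k) hS
  rw [gmass_mul_gD (t := .leaf S) (fun k => (hπ k).le) y hα hpos]
  obtain ⟨k₀, hk₀⟩ := hS
  have hzero : ∀ i, i ≠ y k₀ → gmassGroup π y i (.leaf S) = 0 := by
    intro i hi
    refine Finset.sum_eq_zero fun k hk => ?_
    obtain ⟨hkS, rfl⟩ := Finset.mem_filter.mp hk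
    exact absurd (hpure k hkS k₀ hk₀) hi
  have hfull : gmassGroup π y (y k₀) (.leaf S) = ∑ k ∈ S, π k := by
    rw [gmassGroup, BTree.objs, Finset.filter_true_of_mem fun k hk => hpure k hk k₀ hk₀]
  rw [Finset.sum_eq_single (y k₀)
    (fun i _ hi => by rw [hzero i hi, Real.zero_rpow hα]) (by simp), hfull, one_div,
    Real.rpow_rpow_inv hpos.le hα]

theorem BTree.objs_nonempty {t : BTree (Finset ι)} (hne : ∀ S ∈ t.leaves, S.Nonempty) :
    t.objs.Nonempty := by
  induction t with
  | leaf S => exact hne S (by simp [BTree.leaves])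
  | node l r ihl _ =>
    exact (ihl fun S hS => hne S (List.mem_append_left _ hS)).mono Finset.subset_union_left

/-- **Lemma (telescoping decomposition of the Rényi mass).** For `α ∈ (0,1)` and any
group-identification tree,
`(∑_{i=1}^m π_{Θ^i}^α)^{1/α} - π_Θ
  = ∑_{a ∈ I} [π_{Θ_a} D_α(Θ_a) - π_{Θ_{l(a)}} D_α(Θ_{l(a)}) - π_{Θ_{r(a)}} D_α(Θ_{r(a)})]`. -/
theorem renyi_mass_telescoping {ι : Type} [Fintype ι] [DecidableEq ι] {m : ℕ}
    (π : ι → ℝ) (hπ : ∀ k, 0 < π k) (y : ι → Fin m)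
    (α : ℝ) (hα0 : 0 < α) (hα1 : α < 1)
    (T : BTree (Finset ι))
    (hne : ∀ S ∈ T.leaves, S.Nonempty)
    (hdisj : T.leaves.Pairwise Disjoint)
    (hunion : T.objs = Finset.univ)
    (hpure : ∀ S ∈ T.leaves, ∀ k ∈ S, ∀ k' ∈ S, y k = y k') :
    (∑ i : Fin m, (∑ k ∈ Finset.univ.filter (fun k => y k = i), π k) ^ α) ^ (1 / α)
        - (∑ k, π k)
      = (T.internals.map fun p =>
          gmass π p.1 * gD π y α p.1
            - gmass π p.1.left * gD π y α p.1.left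
            - gmass π p.1.right * gD π y α p.1.right).sum := by
  have hα : α ≠ 0 := hα0.ne'
  have hT : 0 < gmass π T := Finset.sum_pos (fun k _ => hπ k) (BTree.objs_nonempty hne)
  have hleaves : (T.leaves.map fun S => gmass π (.leaf S) * gD π y α (.leaf S))
      = T.leaves.map fun S => ∑ k ∈ S, π k :=
    List.map_congr_left fun S hS => gmass_mul_gD_leaf hπ y hα (hne S hS) (hpure S hS)
  rw [sum_map_internals_sub_children (fun t => gmass π t * gD π y α t), hleaves,
    ← gmass_eq_sum_leaves π T hdisj, gmass_mul_gD (fun k => (hπ k).le) y hα hT]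
  simp only [gmass, gmassGroup, hunion]
end
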